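/- For every IMM execution graph G, the RC11-style synchronizes-with relation is contained in IMM's synchronizes-with relation: sw_RC11 ⊆ sw, and consequently hb_RC11 = (po ∪ sw_RC11)⁺ ⊆ hb = (po ∪ sw)⁺. -/

import Mathlib

/-! ## Basic definitions: events, labels, relations -/

abbrev Loc := ℕ
abbrev Val := ℕ

inductive Mode
  | rlx | acq | rel | acqrel | sc
deriving DecidableEq

inductive ExFlag
  | notex | ex
deriving DecidableEq

inductive Strength
  | normal | strong
deriving DecidableEq

inductive Label
  | read (o : Mode) (x : Loc) (v : Val) (s : ExFlag)
  | write (o : Mode) (x : Loc) (v : Val) (st : Strength)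
  | fence (o : Mode)
deriving DecidableEq

inductive Event
  | init (x : Loc)
  | ev (tid : ℕ) (sn : ℚ)
deriving DecidableEq

def Event.isInit : Event → Prop
  | .init _ => True
  | .ev _ _ => False

/-- the set of initialization events -/
def InitE : Set Event := {e | e.isInit}

/-- the `sequenced-before` partial order on events: initialization events precede all
non-initialization events, and events of the same thread are ordered by serial number -/
def evLt : Event → Event → Prop
  | .init _, .ev _ _ => True
  | .ev i n, .ev j m => i = j ∧ n < m
  | _, _ => False

abbrev REv := Event → Event → Prop

/-- relational composition `r ; s` -/
def seqR (r s : REv) : REv := fun a c => ∃ b, r a b ∧ s b c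

infixr:70 " ⬝ " => seqR

/-- identity relation on a set: `[A]` -/
def eqv (A : Set Event) : REv := fun a b => a = b ∧ a ∈ A

notation:max "⦗" A "⦘" => eqv A

/-- union of relations -/
def runion (r s : REv) : REv := fun a b => r a b ∨ s a b

infixl:65 " ∪ᵣ " => runion

/-- reflexive closure `r^?` -/
def rcl (r : REv) : REv := fun a b => a = b ∨ r a b

/-- transitive closure `r⁺` -/
def tcl (r : REv) : REv := Relation.TransGen r

/-- reflexive-transitive closure `r*` -/
def rtcl (r : REv) : REv := Relation.ReflTransGen r

/-- inverse relation `r⁻¹` -/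
def transp (r : REv) : REv := fun a b => r b a

def rdom (r : REv) : Set Event := {a | ∃ b, r a b}

def rcodom (r : REv) : Set Event := {b | ∃ a, r a b}

/-- immediate edges: `imm(r) = r ∖ r;r` -/
def immediate (r : REv) : REv := fun a b => r a b ∧ ¬ (r ⬝ r) a b

def acyclic (r : REv) : Prop := Irreflexive (tcl r)

/-- `r` totally orders `A` -/
def totalOn (A : Set Event) (r : REv) : Prop :=
  ∀ a ∈ A, ∀ b ∈ A, a ≠ b → r a b ∨ r b a

def Label.locOf : Label → Option Loc
  | .read _ x _ _ => some x
  | .write _ x _ _ => some x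
  | .fence _ => none

def Label.valOf : Label → Option Val
  | .read _ _ v _ => some v
  | .write _ _ v _ => some v
  | .fence _ => none

/-! ## IMM execution graphs -/

structure Execution where
  E : Set Event
  lab : Event → Label
  rmw : REv
  data : REv
  addr : REv
  ctrl : REv
  casdep : REv
  rf : REv
  co : REv

namespace Execution

variable (G : Execution)

def loc (e : Event) : Option Loc := (G.lab e).locOf
def valu (e : Event) : Option Val := (G.lab e).valOf

/-- read events -/
def R : Set Event := {e | e ∈ G.E ∧ ∃ o x v s, G.lab e = .read o x v s}
/-- write events -/
def W : Set Event := {e | e ∈ G.E ∧ ∃ o x v st, G.lab e = .write o x v st}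
/-- fence events -/
def F : Set Event := {e | e ∈ G.E ∧ ∃ o, G.lab e = .fence o}
/-- acquire reads -/
def Racq : Set Event := {e | e ∈ G.E ∧ ∃ x v s, G.lab e = .read .acq x v s}
/-- exclusive reads -/
def Rex : Set Event := {e | e ∈ G.E ∧ ∃ o x v, G.lab e = .read o x v .ex}
/-- release writes -/
def Wrel : Set Event := {e | e ∈ G.E ∧ ∃ x v st, G.lab e = .write .rel x v st}
/-- strong writes -/
def Wstrong : Set Event := {e | e ∈ G.E ∧ ∃ o x v, G.lab e = .write o x v .strong}
/-- writes to location `x` -/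
def Wloc (x : Loc) : Set Event := {e | e ∈ G.W ∧ G.loc e = some x}
/-- reads from location `x` -/
def Rloc (x : Loc) : Set Event := {e | e ∈ G.R ∧ G.loc e = some x}
/-- SC fences -/
def Fsc : Set Event := {e | e ∈ G.E ∧ G.lab e = .fence .sc}
/-- fences of mode exactly `rel` -/
def Frel : Set Event := {e | e ∈ G.E ∧ G.lab e = .fence .rel}
/-- fences whose mode is at least `rel` (i.e. `rel`, `acqrel` or `sc`) -/
def FgeRel : Set Event :=
  {e | e ∈ G.E ∧ (G.lab e = .fence .rel ∨ G.lab e = .fence .acqrel ∨ G.lab e = .fence .sc)}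
/-- fences whose mode is at least `acq` (i.e. `acq`, `acqrel` or `sc`) -/
def FgeAcq : Set Event :=
  {e | e ∈ G.E ∧ (G.lab e = .fence .acq ∨ G.lab e = .fence .acqrel ∨ G.lab e = .fence .sc)}

/-- program order -/
def po : REv := fun a b => a ∈ G.E ∧ b ∈ G.E ∧ evLt a b

/-- both events access the same location -/
def sameLoc : REv := fun a b => ∃ x, G.loc a = some x ∧ G.loc b = some x

/-- `po|loc` -/
def poloc : REv := fun a b => G.po a b ∧ G.sameLoc a b

def rfi : REv := fun a b => G.rf a b ∧ G.po a b
def rfe : REv := fun a b => G.rf a b ∧ ¬ G.po a b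
def coi : REv := fun a b => G.co a b ∧ G.po a b
def coe : REv := fun a b => G.co a b ∧ ¬ G.po a b

/-- from-read -/
def fr : REv := transp G.rf ⬝ G.co
def fri : REv := fun a b => G.fr a b ∧ G.po a b
def fre : REv := fun a b => G.fr a b ∧ ¬ G.po a b

/-- release sequence -/
def rs : REv :=
  ⦗G.W⦘ ⬝ G.poloc ⬝ ⦗G.W⦘ ∪ᵣ ⦗G.W⦘ ⬝ rtcl (rcl G.poloc ⬝ G.rf ⬝ G.rmw)

/-- release prefix -/
def release : REv := (⦗G.Wrel⦘ ∪ᵣ ⦗G.FgeRel⦘ ⬝ G.po) ⬝ G.rs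

/-- synchronizes with -/
def sw : REv :=
  G.release ⬝ (G.rfi ∪ᵣ rcl G.poloc ⬝ G.rfe) ⬝ (⦗G.Racq⦘ ∪ᵣ G.po ⬝ ⦗G.FgeAcq⦘)

/-- happens-before -/
def hb : REv := tcl (G.po ∪ᵣ G.sw)

/-- extended coherence order -/
def eco : REv := G.rf ∪ᵣ G.co ⬝ rcl G.rf ∪ᵣ G.fr ⬝ rcl G.rf

/-- barrier order -/
def bob : REv :=
  G.po ⬝ ⦗G.Wrel⦘ ∪ᵣ ⦗G.Racq⦘ ⬝ G.po ∪ᵣ G.po ⬝ ⦗G.F⦘ ∪ᵣ ⦗G.F⦘ ⬝ G.po ∪ᵣ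
    ⦗G.Wrel⦘ ⬝ G.poloc ⬝ ⦗G.W⦘

/-- syntactic dependencies -/
def deps : REv :=
  G.data ∪ᵣ G.ctrl ∪ᵣ G.addr ⬝ rcl G.po ∪ᵣ G.casdep ∪ᵣ ⦗G.Rex⦘ ⬝ G.po

/-- preserved program order -/
def ppo : REv := ⦗G.R⦘ ⬝ tcl (G.deps ∪ᵣ G.rfi) ⬝ ⦗G.W⦘

def detour : REv := fun a b => (G.coe ⬝ G.rfe) a b ∧ G.po a b

/-- partial SC fence order -/
def psc : REv := ⦗G.Fsc⦘ ⬝ G.hb ⬝ G.eco ⬝ G.hb ⬝ ⦗G.Fsc⦘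

/-- the acyclicity relation of IMM -/
def ar : REv :=
  G.rfe ∪ᵣ G.bob ∪ᵣ G.ppo ∪ᵣ G.detour ∪ᵣ G.psc ∪ᵣ ⦗G.Wstrong⦘ ⬝ G.po ⬝ ⦗G.W⦘

/-! RC11-style variants -/

def rsRC11 : REv := ⦗G.W⦘ ⬝ rcl G.poloc ⬝ rtcl (G.rf ⬝ G.rmw)

def releaseRC11 : REv := (⦗G.Wrel⦘ ∪ᵣ ⦗G.FgeRel⦘ ⬝ G.po) ⬝ G.rsRC11

def swRC11 : REv := G.releaseRC11 ⬝ G.rf ⬝ (⦗G.Racq⦘ ∪ᵣ G.po ⬝ ⦗G.FgeAcq⦘)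

def hbRC11 : REv := tcl (G.po ∪ᵣ G.swRC11)

end Execution

/-- Well-formedness of an IMM execution graph -/
structure ExecWf (G : Execution) : Prop where
  finE : G.E.Finite
  init_lab : ∀ x, Event.init x ∈ G.E →
    G.lab (Event.init x) = Label.write .rlx x 0 .normal
  read_mode : ∀ e ∈ G.E, ∀ o x v s, G.lab e = .read o x v s → o = Mode.rlx ∨ o = Mode.acq
  write_mode : ∀ e ∈ G.E, ∀ o x v st, G.lab e = .write o x v st → o = Mode.rlx ∨ o = Mode.rel
  fence_mode : ∀ e ∈ G.E, ∀ o, G.lab e = .fence o →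
    o = Mode.acq ∨ o = Mode.rel ∨ o = Mode.acqrel ∨ o = Mode.sc
  rmw_sub : ∀ a b, G.rmw a b → a ∈ G.Rex ∧ b ∈ G.W ∧ G.sameLoc a b ∧ immediate G.po a b
  strong_rmw : G.Wstrong ⊆ rcodom G.rmw
  data_sub : ∀ a b, G.data a b → a ∈ G.R ∧ G.po a b ∧ b ∈ G.W
  addr_sub : ∀ a b, G.addr a b → a ∈ G.R ∧ G.po a b ∧ (b ∈ G.R ∨ b ∈ G.W)
  ctrl_sub : ∀ a b, G.ctrl a b → a ∈ G.R ∧ G.po a b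
  ctrl_po : ∀ a b c, G.ctrl a b → G.po b c → G.ctrl a c
  casdep_sub : ∀ a b, G.casdep a b → a ∈ G.R ∧ G.po a b ∧ b ∈ G.Rex
  rf_sub : ∀ a b, G.rf a b → a ∈ G.W ∧ b ∈ G.R ∧ G.sameLoc a b
  rf_val : ∀ a b, G.rf a b → G.valu a = G.valu b
  rf_func : ∀ a b c, G.rf a c → G.rf b c → a = b
  co_sub : ∀ a b, G.co a b → a ∈ G.W ∧ b ∈ G.W ∧ G.sameLoc a b
  co_trans : Transitive G.co
  co_irr : Irreflexive G.co

/-- IMM-consistency (Definition 3.1) -/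
def IMMConsistent (G : Execution) : Prop :=
  rcodom G.rf = G.R ∧
  (∀ x, totalOn (G.Wloc x) G.co) ∧
  Irreflexive (G.hb ⬝ rcl G.eco) ∧
  (∀ a b, G.rmw a b → ¬ (G.fre ⬝ G.coe) a b) ∧
  acyclic G.ar

/-- An RC11 release sequence that ends in a write is an IMM release sequence. -/
theorem Execution.rs_of_rsRC11 (G : Execution) {a b : Event} (hb : b ∈ G.W)
    (h : G.rsRC11 a b) : G.rs a b := by
  obtain ⟨_, ⟨rfl, ha⟩, c, hac, hcb⟩ := h
  rcases Relation.ReflTransGen.cases_head hcb with rfl | ⟨d, ⟨r, hcr, hrd⟩, hdb⟩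
  · rcases hac with rfl | hac
    · exact Or.inr ⟨a, ⟨rfl, ha⟩, Relation.ReflTransGen.refl⟩
    · exact Or.inl ⟨a, ⟨rfl, ha⟩, c, hac, rfl, hb⟩
  · refine Or.inr ⟨a, ⟨rfl, ha⟩, Relation.ReflTransGen.head ⟨c, hac, r, hcr, hrd⟩ ?_⟩
    exact Relation.ReflTransGen.mono (fun x _ h => ⟨x, Or.inl rfl, h⟩) _ _ hdb

theorem Execution.rfi_or_rfe_of_rf (G : Execution) {a b : Event} (h : G.rf a b) :
    (G.rfi ∪ᵣ rcl G.poloc ⬝ G.rfe) a b := by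
  by_cases hpo : G.po a b
  · exact Or.inl ⟨h, hpo⟩
  · exact Or.inr ⟨a, Or.inl rfl, h, hpo⟩

theorem Execution.sw_of_swRC11 (G : Execution) (hwf : ExecWf G) {a b : Event}
    (h : G.swRC11 a b) : G.sw a b := by
  obtain ⟨w, ⟨c, hac, hcw⟩, r, hwr, hrb⟩ := h
  exact ⟨w, ⟨c, hac, G.rs_of_rsRC11 (hwf.rf_sub w r hwr).1 hcw⟩, r,
    G.rfi_or_rfe_of_rf hwr, hrb⟩

/-- For every IMM execution graph `G`, the RC11-style synchronizes-with
relation is contained in IMM's synchronizes-with relation, and consequently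
`hb_RC11 ⊆ hb`. -/
theorem swRC11_subset_sw_and_hbRC11_subset_hb (G : Execution) (hwf : ExecWf G) :
    (∀ a b, G.swRC11 a b → G.sw a b) ∧ (∀ a b, G.hbRC11 a b → G.hb a b) := by
  have hsw : ∀ a b, G.swRC11 a b → G.sw a b := fun _ _ => G.sw_of_swRC11 hwf
  exact ⟨hsw, Relation.TransGen.mono fun a b => Or.imp_right (hsw a b)⟩
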